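/- The matrix S_8 (the 8×8 complex Hadamard matrix with log-matrix (1/4)·M, M as given) is not equivalent to any Dita-type matrix: there is no partition of {1,...,8} into two 4-element index sets I_1, I_2 together with 4 pairs of rows of log S_8 such that each pair is equivalent with respect to both I_1 and I_2, nor a partition into four 2-element sets with two 4-tuples of rows equivalent with respect to all four sets; the same holds for the transpose of S_8. -/

import Mathlib

open Matrix Finset

/-- The log-matrix (times 4) of `S₈`. -/
def M8 : Matrix (Fin 8) (Fin 8) ℕ :=
  !![0,0,0,0,0,0,0,0;
     0,2,1,3,0,2,1,3;
     0,2,3,1,0,2,3,1;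
     0,0,2,2,1,1,3,3;
     0,1,0,1,2,3,2,3;
     0,3,0,3,2,1,2,1;
     0,2,2,0,2,0,0,2;
     0,0,2,2,3,3,1,1]

/-- The log-matrix of `S₈`. -/
noncomputable def logS8 : Matrix (Fin 8) (Fin 8) ℝ := fun j k => (M8 j k : ℝ) / 4

/-- The `(k)`-`n`-Dita pattern of a real `8×8` (log-)matrix: a partition of the rows
into `n` groups of `k` rows (given by the fibers of `g`), and `k` pairwise disjoint
`n`-element column index sets `I_1,…,I_k`, such that any two rows of a common group
are `I_m`-equivalent for every `m` (the fractional parts of the entrywise differences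
agree on each `I_m`). -/
def DitaPattern (k n : ℕ) (A : Matrix (Fin 8) (Fin 8) ℝ) : Prop :=
  ∃ (g : Fin 8 → Fin n) (I : Fin k → Finset (Fin 8)),
    (∀ j : Fin n, (Finset.univ.filter fun s => g s = j).card = k) ∧
    (∀ m : Fin k, (I m).card = n) ∧
    (∀ m m' : Fin k, m ≠ m' → Disjoint (I m) (I m')) ∧
    (∀ s t : Fin 8, g s = g t → ∀ m : Fin k,
      ∃ c : ℝ, ∀ i ∈ I m, Int.fract (A s i - A t i) = c)

/-- Rows `s`, `t` of a log-matrix with entries in `ℤ/4` have the same entrywise difference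
modulo `4` in the columns `i` and `j`. -/
def SameDiff (M : Matrix (Fin 8) (Fin 8) ℕ) (s t i j : Fin 8) : Prop :=
  (M s i + M t j) % 4 = (M t i + M s j) % 4

instance (M : Matrix (Fin 8) (Fin 8) ℕ) (s t i j : Fin 8) : Decidable (SameDiff M s t i j) :=
  inferInstanceAs (Decidable (_ = _))

lemma sameDiff_of_fract_eq {M : Matrix (Fin 8) (Fin 8) ℕ} {s t i j : Fin 8}
    (h : Int.fract ((M s i : ℝ) / 4 - (M t i : ℝ) / 4) =
      Int.fract ((M s j : ℝ) / 4 - (M t j : ℝ) / 4)) :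
    SameDiff M s t i j := by
  obtain ⟨z, hz⟩ := Int.fract_eq_fract.1 h
  have hz' : (M s i : ℤ) + M t j = M t i + M s j + 4 * z := by
    have : (M s i : ℝ) + M t j = M t i + M s j + 4 * z := by linarith
    exact_mod_cast this
  unfold SameDiff
  omega

/-- In a Dita pattern whose index sets exhaust the columns, every column belongs to an index set
of `n` columns on which all pairs of rows of a common group have constant difference. -/
lemma DitaPattern.exists_groups {k n : ℕ} (hkn : k * n = 8) {M : Matrix (Fin 8) (Fin 8) ℕ}
    (h : DitaPattern k n fun j l => (M j l : ℝ) / 4) :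
    ∃ g : Fin 8 → Fin n, (∀ j, (univ.filter fun s => g s = j).card = k) ∧
      ∀ i, ∃ J : Finset (Fin 8), J.card = n ∧
        ∀ j ∈ J, ∀ s t, g s = g t → SameDiff M s t i j := by
  obtain ⟨g, I, hg, hI, hdisj, heq⟩ := h
  refine ⟨g, hg, fun i => ?_⟩
  have hcover : univ.biUnion I = univ := by
    rw [← card_eq_iff_eq_univ, card_biUnion fun m _ m' _ hm => hdisj m m' hm]
    simp [hI, hkn]
  obtain ⟨m, -, him⟩ := mem_biUnion.1 (hcover ▸ mem_univ i)
  refine ⟨I m, hI m, fun j hj s t hst => ?_⟩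
  obtain ⟨c, hc⟩ := heq s t hst m
  exact sameDiff_of_fract_eq ((hc i him).trans (hc j hj).symm)

lemma DitaPattern.exists_partners {M : Matrix (Fin 8) (Fin 8) ℕ}
    (h : DitaPattern 2 4 fun j l => (M j l : ℝ) / 4) (s s' : Fin 8) :
    ∃ t ≠ s, ∃ t' ≠ s', ∀ i,
      4 ≤ (univ.filter fun j => SameDiff M s t i j ∧ SameDiff M s' t' i j).card := by
  obtain ⟨g, hg, hJ⟩ := h.exists_groups rfl
  have partner (s : Fin 8) : ∃ t ≠ s, g s = g t := by
    obtain ⟨t, ht, hts⟩ := exists_mem_ne (by rw [hg (g s)]; norm_num) s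
    exact ⟨t, hts, (mem_filter.1 ht).2.symm⟩
  obtain ⟨t, hts, hst⟩ := partner s
  obtain ⟨t', hts', hst'⟩ := partner s'
  refine ⟨t, hts, t', hts', fun i => ?_⟩
  obtain ⟨J, hcard, hsame⟩ := hJ i
  rw [← hcard]
  exact card_le_card fun j hj =>
    mem_filter.2 ⟨mem_univ j, hsame j hj s t hst, hsame j hj s' t' hst'⟩

lemma DitaPattern.exists_quadruple {M : Matrix (Fin 8) (Fin 8) ℕ}
    (h : DitaPattern 4 2 fun j l => (M j l : ℝ) / 4) (s : Fin 8) :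
    ∃ t u v, t ≠ s ∧ u ≠ s ∧ v ≠ s ∧ t ≠ u ∧ t ≠ v ∧ u ≠ v ∧
      ∀ i, ∃ j ≠ i, SameDiff M s t i j ∧ SameDiff M s u i j ∧ SameDiff M s v i j := by
  obtain ⟨g, hg, hJ⟩ := h.exists_groups rfl
  have hcard : ((univ.filter fun r => g r = g s).erase s).card = 3 := by
    rw [card_erase_of_mem (by simp), hg]
  obtain ⟨t, u, v, htu, htv, huv, hset⟩ := card_eq_three.1 hcard
  have mem {r : Fin 8} (hr : r ∈ ({t, u, v} : Finset (Fin 8))) : r ≠ s ∧ g s = g r := by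
    rw [← hset, mem_erase, mem_filter] at hr
    exact ⟨hr.1, hr.2.2.symm⟩
  have ht := mem (r := t) (by simp)
  have hu := mem (r := u) (by simp)
  have hv := mem (r := v) (by simp)
  refine ⟨t, u, v, ht.1, hu.1, hv.1, htu, htv, huv, fun i => ?_⟩
  obtain ⟨J, hJcard, hsame⟩ := hJ i
  obtain ⟨j, hj, hji⟩ := exists_mem_ne (by rw [hJcard]; norm_num) i
  exact ⟨j, hji, hsame j hj s t ht.2, hsame j hj s u hu.2, hsame j hj s v hv.2⟩

/-- Neither `S₈` nor its transpose is of Dita type: the log-matrix of `S₈` (and of its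
transpose) admits no `(2)`-`4` pattern (two 4-element index sets with 4 pairs of rows
equivalent w.r.t. both) and no `(4)`-`2` pattern (four 2-element index sets with two
4-tuples of rows equivalent w.r.t. all four). -/
theorem S8_not_dita_type :
    ¬ DitaPattern 2 4 logS8 ∧ ¬ DitaPattern 4 2 logS8 ∧
    ¬ DitaPattern 2 4 logS8ᵀ ∧ ¬ DitaPattern 4 2 logS8ᵀ := by
  refine ⟨fun h => ?_, fun h => ?_, fun h => ?_, fun h => ?_⟩
  · exact absurd (DitaPattern.exists_partners (M := M8) h 0 1) (by decide +kernel)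
  · exact absurd (DitaPattern.exists_quadruple (M := M8) h 0) (by decide +kernel)
  · exact absurd (DitaPattern.exists_partners (M := M8ᵀ) h 0 1) (by decide +kernel)
  · exact absurd (DitaPattern.exists_quadruple (M := M8ᵀ) h 0) (by decide +kernel)
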